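/- Let F and G be groups and (X,π) a uniformly convex isometric Banach (F×G)-module without almost invariant unit vectors, such that X^F = X^G = {0} (where F and G are identified with their images in F×G). Then H¹(F×G, X) = {0}. -/

import Mathlib

noncomputable section

open scoped BigOperators

variable {F G : Type*} [Group F] [Group G]
variable {X : Type*} [NormedAddCommGroup X] [NormedSpace ℝ X]

/-- Almost invariant unit vectors for a module over the group `Γ`. -/
def HasAIUV {Γ : Type*} [Group Γ] (π : Γ →* (X →L[ℝ] X)) : Prop :=
  ∀ E : Finset Γ, ∀ ε : ℝ, 0 < ε →
    ∃ x : X, ‖x‖ = 1 ∧ ∀ g ∈ E, ‖x - π g x‖ < ε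

/-- The degree-1 cocycle condition. -/
def IsCocycle {Γ : Type*} [Group Γ] (π : Γ →* (X →L[ℝ] X)) (φ : Γ → X) : Prop :=
  ∀ g f : Γ, φ (g * f) = π g (φ f) + φ g

section Averages

variable {Γ : Type*} [Group Γ]

/-- The average of the operators `π s` over a finite set `S`. -/
def linearAverage (π : Γ →* (X →L[ℝ] X)) (S : Finset Γ) (x : X) : X :=
  (S.card : ℝ)⁻¹ • ∑ s ∈ S, π s x

/-- The affine action `x ↦ π p x + φ p` associated with a cocycle `φ`. -/
def affineAction (π : Γ →* (X →L[ℝ] X)) (φ : Γ → X) (p : Γ) (x : X) : X :=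
  π p x + φ p

/-- The average of the affine action of `φ` over a finite set `S`. -/
def affineAverage (π : Γ →* (X →L[ℝ] X)) (φ : Γ → X) (S : Finset Γ) (x : X) : X :=
  (S.card : ℝ)⁻¹ • ∑ s ∈ S, affineAction π φ s x

variable {π : Γ →* (X →L[ℝ] X)} {φ : Γ → X}

lemma affineAction_mul (hφ : IsCocycle π φ) (p q : Γ) (x : X) :
    affineAction π φ (p * q) x = affineAction π φ p (affineAction π φ q x) := by
  simp only [affineAction, hφ p q, map_mul, mul_apply_eq_comp, map_add]
  abel

lemma affineAction_sub (p : Γ) (x y : X) :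
    affineAction π φ p x - affineAction π φ p y = π p (x - y) := by
  simp only [affineAction, map_sub]
  abel

lemma affineAverage_sub (S : Finset Γ) (x y : X) :
    affineAverage π φ S x - affineAverage π φ S y = linearAverage π S (x - y) := by
  simp only [affineAverage, linearAverage, ← smul_sub, ← Finset.sum_sub_distrib,
    affineAction_sub]

lemma affineAction_affineAverage {T : Finset Γ} (hT : T.Nonempty) (p : Γ) (x : X) :
    affineAction π φ p (affineAverage π φ T x) =
      (T.card : ℝ)⁻¹ • ∑ t ∈ T, affineAction π φ p (affineAction π φ t x) := by
  have hn : (T.card : ℝ) ≠ 0 := by exact_mod_cast hT.card_pos.ne'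
  have h (t : Γ) : affineAction π φ p (affineAction π φ t x) =
      π p (affineAction π φ t x) + φ p := rfl
  simp only [h, Finset.sum_add_distrib, smul_add, Finset.sum_const]
  rw [← Nat.cast_smul_eq_nsmul ℝ, smul_smul, inv_mul_cancel₀ hn, one_smul]
  simp only [affineAverage, affineAction, map_smul, map_sum]

lemma affineAction_affineAverage_comm (hφ : IsCocycle π φ) {T : Finset Γ} (hT : T.Nonempty)
    {p : Γ} (hp : ∀ t ∈ T, p * t = t * p) (x : X) :
    affineAction π φ p (affineAverage π φ T x) =
      affineAverage π φ T (affineAction π φ p x) := by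
  rw [affineAction_affineAverage hT, affineAverage]
  congr 1
  refine Finset.sum_congr rfl fun t ht => ?_
  rw [← affineAction_mul hφ, ← affineAction_mul hφ, hp t ht]

lemma affineAverage_comm (hφ : IsCocycle π φ) {S T : Finset Γ} (hS : S.Nonempty)
    (hT : T.Nonempty) (hST : ∀ s ∈ S, ∀ t ∈ T, s * t = t * s) (x : X) :
    affineAverage π φ S (affineAverage π φ T x) =
      affineAverage π φ T (affineAverage π φ S x) := by
  conv_rhs => rw [affineAverage]
  simp only [affineAction_affineAverage hS]
  rw [affineAverage]
  simp only [affineAction_affineAverage hT, ← Finset.smul_sum]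
  rw [smul_comm, Finset.sum_comm]
  congr 2
  refine Finset.sum_congr rfl fun t ht => Finset.sum_congr rfl fun s hs => ?_
  rw [← affineAction_mul hφ, ← affineAction_mul hφ, hST s hs t ht]

lemma linearAverage_comm {S T : Finset Γ} (hST : ∀ s ∈ S, ∀ t ∈ T, s * t = t * s) (x : X) :
    linearAverage π S (linearAverage π T x) = linearAverage π T (linearAverage π S x) := by
  simp only [linearAverage, map_smul, map_sum, ← Finset.smul_sum]
  rw [smul_comm, Finset.sum_comm]
  congr 2
  refine Finset.sum_congr rfl fun t ht => Finset.sum_congr rfl fun s hs => ?_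
  rw [← mul_apply_eq_comp, ← mul_apply_eq_comp, ← map_mul, ← map_mul,
    hST s hs t ht]

lemma norm_linearAverage_le (hiso : ∀ p x, ‖π p x‖ = ‖x‖) {S : Finset Γ} (hS : S.Nonempty)
    (x : X) : ‖linearAverage π S x‖ ≤ ‖x‖ := by
  have hn : (0 : ℝ) < S.card := by exact_mod_cast hS.card_pos
  rw [linearAverage, norm_smul, norm_inv, Real.norm_natCast, inv_mul_le_iff₀ hn]
  refine (norm_sum_le _ _).trans ?_
  simp [hiso]

/-- In a uniformly convex isometric module, averaging over `S ∋ 1` contracts uniformly all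
vectors which are moved by a definite proportion by some element of `S`. -/
lemma exists_norm_linearAverage_le [UniformConvexSpace X] (hiso : ∀ p x, ‖π p x‖ = ‖x‖)
    {S : Finset Γ} (h1 : 1 ∈ S) {ε : ℝ} (hε : 0 < ε) :
    ∃ k : ℝ, k < 1 ∧ ∀ x : X, ∀ s ∈ S, ε * ‖x‖ ≤ ‖x - π s x‖ →
      ‖linearAverage π S x‖ ≤ k * ‖x‖ := by
  classical
  obtain ⟨δ, hδ, h⟩ := exists_forall_sphere_dist_add_le_two_sub X hε
  have hn : (0 : ℝ) < S.card := by exact_mod_cast Finset.card_pos.2 ⟨1, h1⟩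
  refine ⟨1 - δ / S.card, sub_lt_self _ (div_pos hδ hn), fun x s hs hx => ?_⟩
  rcases eq_or_ne x 0 with rfl | hx0
  · simp [linearAverage]
  have hxpos : 0 < ‖x‖ := norm_pos_iff.2 hx0
  have hs1 : s ≠ 1 := by
    rintro rfl
    have := mul_pos hε hxpos
    simp at hx
    linarith
  have hadd : ‖x + π s x‖ ≤ (2 - δ) * ‖x‖ := by
    have hu : ‖‖x‖⁻¹ • x‖ = 1 := by
      rw [norm_smul, norm_inv, norm_norm, inv_mul_cancel₀ hxpos.ne']
    have := h hu ((hiso s _).trans hu) (by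
      rw [map_smul, ← smul_sub, norm_smul, norm_inv, norm_norm, le_inv_mul_iff₀ hxpos]
      linarith)
    rw [map_smul, ← smul_add, norm_smul, norm_inv, norm_norm, inv_mul_le_iff₀ hxpos] at this
    linarith
  have hs' : s ∈ S.erase 1 := Finset.mem_erase.2 ⟨hs1, hs⟩
  have hcard : (((S.erase 1).erase s).card : ℝ) = S.card - 2 := by
    have e1 := Finset.card_erase_add_one hs'
    have e2 := Finset.card_erase_add_one h1
    have : ((S.erase 1).erase s).card + 2 = S.card := by omega
    rw [← this]
    push_cast
    ring
  have hrest : ‖∑ t ∈ (S.erase 1).erase s, π t x‖ ≤ (S.card - 2) * ‖x‖ := by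
    refine (norm_sum_le _ _).trans ?_
    simp [hiso, hcard]
  rw [linearAverage, norm_smul, norm_inv, Real.norm_natCast, inv_mul_le_iff₀ hn,
    ← Finset.add_sum_erase _ _ h1, ← Finset.add_sum_erase _ _ hs', ← add_assoc, map_one,
    one_apply_eq_self]
  refine (norm_add_le_of_le hadd hrest).trans (le_of_eq ?_)
  field_simp
  ring

lemma map_eq_of_linearAverage_eq [UniformConvexSpace X] (hiso : ∀ p x, ‖π p x‖ = ‖x‖)
    {S : Finset Γ} (h1 : 1 ∈ S) {x : X} (hx : linearAverage π S x = x) {s : Γ} (hs : s ∈ S) :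
    π s x = x := by
  by_contra hne
  have hd : 0 < ‖x - π s x‖ := norm_pos_iff.2 (sub_ne_zero.2 (Ne.symm hne))
  have hxpos : 0 < ‖x‖ := norm_pos_iff.2 (by rintro rfl; simp at hne)
  obtain ⟨k, hk, h⟩ := exists_norm_linearAverage_le hiso h1 (div_pos hd hxpos)
  have := h x s hs (by rw [div_mul_cancel₀ _ hxpos.ne'])
  rw [hx] at this
  nlinarith

/-- If the commuting sets `S` and `T` together move every vector by a definite proportion, then
the affine averages over `S` and `T` have a common fixed point. -/
lemma exists_affineAverage_eq [CompleteSpace X] [UniformConvexSpace X]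
    (hiso : ∀ p x, ‖π p x‖ = ‖x‖) (hφ : IsCocycle π φ) {S T : Finset Γ} (hS : 1 ∈ S)
    (hT : 1 ∈ T) (hST : ∀ s ∈ S, ∀ t ∈ T, s * t = t * s) {ε : ℝ} (hε : 0 < ε)
    (hgap : ∀ x : X, (∃ s ∈ S, ε * ‖x‖ ≤ ‖x - π s x‖) ∨ ∃ t ∈ T, ε * ‖x‖ ≤ ‖x - π t x‖) :
    ∃ z : X, affineAverage π φ S z = z ∧ affineAverage π φ T z = z := by
  have hSn : S.Nonempty := ⟨1, hS⟩
  have hTn : T.Nonempty := ⟨1, hT⟩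
  obtain ⟨k, hk, hkS⟩ := exists_norm_linearAverage_le hiso hS hε
  obtain ⟨l, hl, hlT⟩ := exists_norm_linearAverage_le hiso hT hε
  have hbound (x : X) : ‖linearAverage π S (linearAverage π T x)‖ ≤ max k l * ‖x‖ := by
    rcases hgap x with ⟨s, hs, h⟩ | ⟨t, ht, h⟩
    · rw [linearAverage_comm hST]
      refine (norm_linearAverage_le hiso hTn _).trans ((hkS x s hs h).trans ?_)
      gcongr
      exact le_max_left _ _
    · refine (norm_linearAverage_le hiso hSn _).trans ((hlT x t ht h).trans ?_)
      gcongr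
      exact le_max_right _ _
  have hcontr : ContractingWith (max k l).toNNReal
      (fun x => affineAverage π φ S (affineAverage π φ T x)) := by
    refine ⟨Real.toNNReal_lt_one.2 (max_lt hk hl), LipschitzWith.of_dist_le_mul fun x y => ?_⟩
    rw [dist_eq_norm, dist_eq_norm, affineAverage_sub, affineAverage_sub]
    refine (hbound _).trans ?_
    gcongr
    exact Real.le_coe_toNNReal _
  have hz := hcontr.fixedPoint_isFixedPt
  set z := ContractingWith.fixedPoint _ hcontr
  have hz' : affineAverage π φ S (affineAverage π φ T z) = z := hz
  refine ⟨z, ?_, ?_⟩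
  · refine hcontr.fixedPoint_unique' ?_ hz
    change affineAverage π φ S (affineAverage π φ T (affineAverage π φ S z)) = _
    rw [← affineAverage_comm hφ hSn hTn hST z, hz']
  · refine hcontr.fixedPoint_unique' ?_ hz
    change affineAverage π φ S (affineAverage π φ T (affineAverage π φ T z)) = _
    rw [affineAverage_comm hφ hSn hTn hST, hz']

lemma map_affineAction_sub_eq [UniformConvexSpace X] (hiso : ∀ p x, ‖π p x‖ = ‖x‖)
    (hφ : IsCocycle π φ) {S : Finset Γ} (hS : 1 ∈ S) {z : X} (hz : affineAverage π φ S z = z)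
    {p : Γ} (hp : ∀ s ∈ S, p * s = s * p) {s : Γ} (hs : s ∈ S) :
    π s (affineAction π φ p z - z) = affineAction π φ p z - z := by
  refine map_eq_of_linearAverage_eq hiso hS ?_ hs
  rw [← affineAverage_sub (φ := φ), ← affineAction_affineAverage_comm hφ ⟨1, hS⟩ hp, hz]

end Averages

lemma exists_gap_of_not_hasAIUV {Γ : Type*} [Group Γ] {π : Γ →* (X →L[ℝ] X)}
    (h : ¬ HasAIUV π) :
    ∃ E : Finset Γ, ∃ ε : ℝ, 0 < ε ∧ ∀ x : X, x ≠ 0 → ∃ p ∈ E, ε * ‖x‖ ≤ ‖x - π p x‖ := by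
  simp only [HasAIUV] at h
  push Not at h
  obtain ⟨E, ε, hε, h⟩ := h
  refine ⟨E, ε, hε, fun x hx => ?_⟩
  have hxpos : 0 < ‖x‖ := norm_pos_iff.2 hx
  obtain ⟨p, hp, hle⟩ := h (‖x‖⁻¹ • x) (by
    rw [norm_smul, norm_inv, norm_norm, inv_mul_cancel₀ hxpos.ne'])
  refine ⟨p, hp, ?_⟩
  rw [map_smul, ← smul_sub, norm_smul, norm_inv, norm_norm, le_inv_mul_iff₀ hxpos] at hle
  linarith

/-- For a product group, the finite set witnessing the absence of almost invariant unit vectors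
may be taken in the union of the two factors. -/
lemma exists_gap_prod {π : (F × G) →* (X →L[ℝ] X)} (hiso : ∀ p x, ‖π p x‖ = ‖x‖)
    (h : ¬ HasAIUV π) :
    ∃ (S : Finset F) (T : Finset G) (ε : ℝ), 1 ∈ S ∧ 1 ∈ T ∧ 0 < ε ∧ ∀ x : X,
      (∃ s ∈ S, ε * ‖x‖ ≤ ‖x - π (s, 1) x‖) ∨ ∃ t ∈ T, ε * ‖x‖ ≤ ‖x - π (1, t) x‖ := by
  classical
  obtain ⟨E, ε, hε, hE⟩ := exists_gap_of_not_hasAIUV h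
  refine ⟨insert 1 (E.image Prod.fst), insert 1 (E.image Prod.snd), ε / 2, by simp, by simp,
    by positivity, fun x => ?_⟩
  rcases eq_or_ne x 0 with rfl | hx
  · exact Or.inl ⟨1, by simp, by simp⟩
  obtain ⟨⟨f, g⟩, hp, hle⟩ := hE x hx
  have hsplit : x - π (f, g) x = (x - π (f, 1) x) + π (f, 1) (x - π (1, g) x) := by
    rw [map_sub, ← mul_apply_eq_comp, ← map_mul]
    simp
  have hnorm : ‖x - π (f, g) x‖ ≤ ‖x - π (f, 1) x‖ + ‖x - π (1, g) x‖ := by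
    rw [hsplit]
    exact (norm_add_le _ _).trans_eq (by rw [hiso])
  by_cases hf : ε / 2 * ‖x‖ ≤ ‖x - π (f, 1) x‖
  · exact Or.inl ⟨f, Finset.mem_insert_of_mem (Finset.mem_image.2 ⟨_, hp, rfl⟩), hf⟩
  · exact Or.inr ⟨g, Finset.mem_insert_of_mem (Finset.mem_image.2 ⟨_, hp, rfl⟩), by linarith⟩

/-- If `(X,π)` is a uniformly convex isometric Banach `F × G`-module without almost
invariant unit vectors and `X^F = X^G = {0}` (identifying `F` and `G` with their images
in `F × G`), then `H¹(F × G, X) = {0}`: every cocycle is a coboundary. -/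
theorem H1_product_vanishes [CompleteSpace X] [UniformConvexSpace X]
    (π : (F × G) →* (X →L[ℝ] X)) (hiso : ∀ (p : F × G) (x : X), ‖π p x‖ = ‖x‖)
    (hnaiuv : ¬ HasAIUV π)
    (hF : ∀ x : X, (∀ f : F, π (f, 1) x = x) → x = 0)
    (hG : ∀ x : X, (∀ g : G, π (1, g) x = x) → x = 0) :
    ∀ φ : F × G → X, IsCocycle π φ → ∃ x : X, ∀ p : F × G, φ p = x - π p x := by
  classical
  intro φ hφ
  obtain ⟨S, T, ε, hS, hT, hε, hgap⟩ := exists_gap_prod hiso hnaiuv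
  let i (A : Finset F) : Finset (F × G) := A.image fun f => (f, 1)
  let j : Finset (F × G) := T.image fun g => (1, g)
  have hi {A : Finset F} {f : F} (hf : f ∈ A) : ((f, 1) : F × G) ∈ i A :=
    Finset.mem_image_of_mem _ hf
  have hj {g : G} (hg : g ∈ T) : ((1, g) : F × G) ∈ j := Finset.mem_image_of_mem _ hg
  have hcomm (A : Finset F) (g : G) : ∀ s ∈ i A, ((1, g) : F × G) * s = s * (1, g) := by
    intro s hs
    obtain ⟨f, -, rfl⟩ := Finset.mem_image.1 hs
    simp
  have hex (A : Finset F) (hA : S ⊆ A) :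
      ∃ z : X, affineAverage π φ (i A) z = z ∧ affineAverage π φ j z = z := by
    refine exists_affineAverage_eq hiso hφ (hi (hA hS)) (hj hT) (fun s hs t ht => ?_) hε
      fun x => ?_
    · obtain ⟨g, -, rfl⟩ := Finset.mem_image.1 ht
      exact (hcomm A g s hs).symm
    · exact (hgap x).imp (fun ⟨s, hs, h⟩ => ⟨_, hi (hA hs), h⟩) fun ⟨t, ht, h⟩ => ⟨_, hj ht, h⟩
  have hfix {A : Finset F} (hA : S ⊆ A) {z : X} (hz : affineAverage π φ (i A) z = z) {f : F}
      (hf : f ∈ A) (g : G) :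
      π (f, 1) (affineAction π φ (1, g) z - z) = affineAction π φ (1, g) z - z :=
    map_affineAction_sub_eq hiso hφ (hi (hA hS)) hz (hcomm A g) (hi hf)
  have hcommπ (f : F) (g : G) (x : X) : π (f, 1) (π (1, g) x) = π (1, g) (π (f, 1) x) := by
    rw [← mul_apply_eq_comp, ← mul_apply_eq_comp, ← map_mul, ← map_mul]
    simp
  obtain ⟨z, hzS, hzT⟩ := hex S subset_rfl
  have hzG (g : G) : affineAction π φ (1, g) z = z := by
    refine sub_eq_zero.1 (hF _ fun f => ?_)
    obtain ⟨z', hzS', hzT'⟩ := hex (insert f S) (Finset.subset_insert f S)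
    suffices z' = z by
      subst this
      exact hfix (Finset.subset_insert f S) hzS' (Finset.mem_insert_self f S) g
    set w := z' - z with hw
    have hwT : ∀ t ∈ T, π (1, t) w = w := fun t ht =>
      map_eq_of_linearAverage_eq hiso (hj hT)
        (by rw [hw, ← affineAverage_sub (φ := φ), hzT, hzT']) (hj ht)
    have hwS : ∀ s ∈ S, π (s, 1) w = w := by
      refine fun s hs => sub_eq_zero.1 (hG _ fun g => ?_)
      have h₁ := hfix (Finset.subset_insert f S) hzS' (Finset.mem_insert_of_mem hs) g
      have h₂ := hfix subset_rfl hzS hs g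
      have h₃ : π (1, g) w - w =
          (affineAction π φ (1, g) z' - z') - (affineAction π φ (1, g) z - z) := by
        rw [hw, ← affineAction_sub (φ := φ)]
        abel
      have h₄ : π (s, 1) (π (1, g) w - w) = π (1, g) w - w := by
        rw [h₃, map_sub, h₁, h₂]
      rw [map_sub, hcommπ] at h₄
      rw [map_sub, sub_eq_sub_iff_sub_eq_sub, h₄]
    have hw0 : ε * ‖w‖ ≤ 0 := by
      rcases hgap w with ⟨s, hs, h⟩ | ⟨t, ht, h⟩
      · simpa [hwS s hs] using h
      · simpa [hwT t ht] using h
    exact sub_eq_zero.1 (norm_le_zero_iff.1 (nonpos_of_mul_nonpos_right hw0 hε))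
  have hzF (f : F) : affineAction π φ (f, 1) z = z := by
    refine sub_eq_zero.1 (hG _ fun g => ?_)
    rw [← affineAction_sub (φ := φ), hzG, ← affineAction_mul hφ]
    have : ((1, g) : F × G) * (f, 1) = (f, 1) * (1, g) := by simp
    rw [this, affineAction_mul hφ, hzG]
  refine ⟨z, fun ⟨f, g⟩ => ?_⟩
  have h : affineAction π φ ((f, 1) * (1, g)) z = z := by rw [affineAction_mul hφ, hzG, hzF]
  rw [Prod.mk_mul_mk, mul_one, one_mul] at h
  exact eq_sub_of_add_eq' h
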